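/- For every ρ > 0 and v > 0, a²·[(ρ/(4a²))(√(v²+4a²)+v)² − ρ·e^{−v/a}] = ρ·e^{v/a}·Φ(−v/a); for every ρ > 0 and v < 0, a²·[(ρ/(4a²))(√(v²+4a²)−v)² − ρ·e^{v/a}] = ρ·e^{−v/a}·Φ(v/a). Equivalently, for a state u = (ρ, ρv), the pressure jump across a closed valve satisfies a²(ρ̂(u) − ρ̌(u)) = ρ·e^{v/a}·Φ(−v/a) when v > 0, and a²(ρ̌(u) − ρ̂(u)) = ρ·e^{−v/a}·Φ(v/a) when v < 0. -/

import Mathlib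

noncomputable def Xi (ζ : ℝ) : ℝ := Real.exp (-ζ/2) - Real.exp (ζ/2)

noncomputable def XiInv : ℝ → ℝ := Function.invFun Xi

noncomputable def Phi (a ν : ℝ) : ℝ := a^2 * Real.exp ν * (Real.exp (XiInv ν) - Real.exp ν)

theorem Xi_eq_neg_two_mul_sinh (ζ : ℝ) : Xi ζ = -2 * Real.sinh (ζ / 2) := by
  rw [Xi, Real.sinh_eq, neg_div]
  ring

theorem Xi_injective : Function.Injective Xi := by
  intro x y h
  rw [Xi_eq_neg_two_mul_sinh, Xi_eq_neg_two_mul_sinh] at h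
  have := Real.sinh_injective (by linarith : Real.sinh (x / 2) = Real.sinh (y / 2))
  linarith

theorem XiInv_eq (ν : ℝ) : XiInv ν = 2 * Real.arsinh (-ν / 2) := by
  have h : Xi (2 * Real.arsinh (-ν / 2)) = ν := by
    rw [Xi_eq_neg_two_mul_sinh, mul_div_cancel_left₀ _ two_ne_zero, Real.sinh_arsinh]
    ring
  calc XiInv ν = XiInv (Xi (2 * Real.arsinh (-ν / 2))) := by rw [h]
    _ = _ := Function.leftInverse_invFun Xi_injective _

theorem exp_XiInv_neg_div {a : ℝ} (ha : 0 < a) (v : ℝ) :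
    Real.exp (XiInv (-(v / a))) = (Real.sqrt (v ^ 2 + 4 * a ^ 2) + v) ^ 2 / (4 * a ^ 2) := by
  have hs : Real.sqrt (1 + (v / a / 2) ^ 2) = Real.sqrt (v ^ 2 + 4 * a ^ 2) / (2 * a) := by
    have h : 1 + (v / a / 2) ^ 2 = (v ^ 2 + 4 * a ^ 2) / (2 * a) ^ 2 := by
      field_simp
      ring
    rw [h, Real.sqrt_div' _ (sq_nonneg _), Real.sqrt_sq (by positivity)]
  rw [XiInv_eq, neg_neg, two_mul, Real.exp_add, Real.exp_arsinh, hs]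
  field_simp
  ring

theorem exp_mul_Phi_neg_div {a : ℝ} (ha : 0 < a) (ρ v : ℝ) :
    a ^ 2 * ((ρ / (4 * a ^ 2)) * (Real.sqrt (v ^ 2 + 4 * a ^ 2) + v) ^ 2
        - ρ * Real.exp (-(v / a)))
      = ρ * Real.exp (v / a) * Phi a (-(v / a)) := by
  have he : Real.exp (v / a) * Real.exp (-(v / a)) = 1 := by
    rw [← Real.exp_add, add_neg_cancel, Real.exp_zero]
  rw [Phi, exp_XiInv_neg_div ha]
  linear_combination (-ρ * a ^ 2 * ((Real.sqrt (v ^ 2 + 4 * a ^ 2) + v) ^ 2 / (4 * a ^ 2)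
    - Real.exp (-(v / a)))) * he

theorem pressure_jump_formula_via_Phi (a : ℝ) (ha : 0 < a) :
    (∀ ρ v : ℝ, 0 < ρ → 0 < v →
      a^2 * ((ρ/(4*a^2)) * (Real.sqrt (v^2 + 4*a^2) + v)^2 - ρ * Real.exp (-v/a))
        = ρ * Real.exp (v/a) * Phi a (-(v/a))) ∧
    (∀ ρ v : ℝ, 0 < ρ → v < 0 →
      a^2 * ((ρ/(4*a^2)) * (Real.sqrt (v^2 + 4*a^2) - v)^2 - ρ * Real.exp (v/a))
        = ρ * Real.exp (-v/a) * Phi a (v/a)) := by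
  refine ⟨fun ρ v _ _ => ?_, fun ρ v _ _ => ?_⟩
  · simpa only [neg_div] using exp_mul_Phi_neg_div ha ρ v
  · simpa only [neg_div, neg_neg, neg_sq, ← sub_eq_add_neg] using
      exp_mul_Phi_neg_div ha ρ (-v)
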